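/- Let u be a fuzzy number and let a, b ∈ [u⁻(0), u⁻(1)] with a < b. Then the following three statements are equivalent: (i) there exists x ∈ (a, b] such that u is not left-continuous at x; (ii) there exist α, β ∈ [u(a), u(b)] with α ≠ β and u⁻(α) = u⁻(β); (iii) the function u⁻ is not strictly increasing on [u(a), u(b)]. -/

import Mathlib

open Set Filter Topology

/-- A fuzzy number: a function `ℝ → ℝ` taking values in `[0,1]`, whose `α`-cuts
(for `α ∈ (0,1]`) and whose `0`-cut (the closure of the support) are nonempty
compact intervals. -/
structure FuzzyNumber where
  f : ℝ → ℝ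
  mem_Icc : ∀ x, f x ∈ Set.Icc (0 : ℝ) 1
  cut_isIcc : ∀ α ∈ Set.Ioc (0 : ℝ) 1, ∃ a b : ℝ, a ≤ b ∧ {x | α ≤ f x} = Set.Icc a b
  supp_isIcc : ∃ a b : ℝ, a ≤ b ∧ closure {x | 0 < f x} = Set.Icc a b

namespace FuzzyNumber

/-- The `α`-cut of a fuzzy number; for `α = 0` it is the closure of the support. -/
noncomputable def cut (u : FuzzyNumber) (α : ℝ) : Set ℝ :=
  if α = 0 then closure {x | 0 < u.f x} else {x | α ≤ u.f x}

/-- Left endpoint `u⁻(α)` of the `α`-cut. -/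
noncomputable def lo (u : FuzzyNumber) (α : ℝ) : ℝ := sInf (u.cut α)

/-- Right endpoint `u⁺(α)` of the `α`-cut. -/
noncomputable def hi (u : FuzzyNumber) (α : ℝ) : ℝ := sSup (u.cut α)

/-- Left endpoint `u_s⁻(α)` of the strong `α`-cut: `lim_{β→α⁺} u⁻(β)` for `α < 1`,
and `u⁻(1)` for `α = 1`.  Since `u⁻` is nondecreasing, this right limit is the
infimum of `u⁻` over `(α,1]`. -/
noncomputable def slo (u : FuzzyNumber) (α : ℝ) : ℝ :=
  if α < 1 then sInf (u.lo '' Set.Ioc α 1) else u.lo 1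

/-- Right endpoint `u_s⁺(α)` of the strong `α`-cut: `lim_{β→α⁺} u⁺(β)` for `α < 1`,
and `u⁺(1)` for `α = 1`. -/
noncomputable def shi (u : FuzzyNumber) (α : ℝ) : ℝ :=
  if α < 1 then sSup (u.hi '' Set.Ioc α 1) else u.hi 1

/-- The sup-min convolution `u∇v` of two fuzzy numbers, as a function on `ℝ`:
`(u∇v)(x) = sup_y min (u y) (v (x - y))`.  Its cut functions satisfy
`(u∇v)⁻(α) = u⁻(α) + v⁻(α)` and `(u∇v)⁺(α) = u⁺(α) + v⁺(α)`. -/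
noncomputable def conv (u v : FuzzyNumber) (x : ℝ) : ℝ :=
  ⨆ y : ℝ, min (u.f y) (v.f (x - y))

end FuzzyNumber

/-- `f` has left derivative `f'` at `x`. -/
def HasLeftDerivAt (f : ℝ → ℝ) (f' x : ℝ) : Prop :=
  HasDerivWithinAt f f' (Set.Iio x) x

/-- `f` has right derivative `f'` at `x`. -/
def HasRightDerivAt (f : ℝ → ℝ) (f' x : ℝ) : Prop :=
  HasDerivWithinAt f f' (Set.Ioi x) x

namespace FuzzyNumber

theorem cut_of_pos (u : FuzzyNumber) {α : ℝ} (hα : 0 < α) : u.cut α = {x | α ≤ u.f x} :=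
  if_neg hα.ne'

theorem bddBelow_cut (u : FuzzyNumber) {α : ℝ} (hα : α ∈ Icc (0 : ℝ) 1) :
    BddBelow (u.cut α) := by
  rcases hα.1.eq_or_lt with rfl | h
  · obtain ⟨p, q, -, h⟩ := u.supp_isIcc
    simp only [cut, if_true, h]
    exact bddBelow_Icc
  · obtain ⟨p, q, -, hc⟩ := u.cut_isIcc α ⟨h, hα.2⟩
    rw [u.cut_of_pos h, hc]
    exact bddBelow_Icc

theorem mem_cut_of_lt (u : FuzzyNumber) {α x : ℝ} (h : α < u.f x) : x ∈ u.cut α := by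
  unfold cut
  split_ifs with h0
  · exact subset_closure (h0 ▸ h)
  · exact h.le

theorem le_f_lo (u : FuzzyNumber) {α : ℝ} (hα : α ∈ Ioc (0 : ℝ) 1) : α ≤ u.f (u.lo α) := by
  obtain ⟨p, q, hpq, h⟩ := u.cut_isIcc α hα
  have hp : p ∈ {x | α ≤ u.f x} := h ▸ left_mem_Icc.2 hpq
  rwa [lo, u.cut_of_pos hα.1, h, csInf_Icc hpq]

theorem monotoneOn_Iic_lo_one (u : FuzzyNumber) : MonotoneOn u.f (Iic (u.lo 1)) := by
  intro x _ y hy hxy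
  rcases (u.mem_Icc x).1.eq_or_lt with h0 | h0
  · exact h0 ▸ (u.mem_Icc y).1
  · obtain ⟨p, q, -, h⟩ := u.cut_isIcc (u.f x) ⟨h0, (u.mem_Icc x).2⟩
    have hx : x ∈ Icc p q := h ▸ le_refl (u.f x)
    have h1 : u.lo 1 ∈ Icc p q :=
      h ▸ (u.mem_Icc x).2.trans (u.le_f_lo (right_mem_Ioc.2 one_pos))
    have hy' : y ∈ {z | u.f x ≤ u.f z} := h ▸ ⟨hx.1.trans hxy, le_trans hy h1.2⟩
    exact hy'

theorem lo_eq_of_forall_lt (u : FuzzyNumber) {α x : ℝ} (hα : 0 < α) (hx : α ≤ u.f x)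
    (h : ∀ y < x, u.f y < α) : u.lo α = x := by
  rw [lo, u.cut_of_pos hα]
  exact IsLeast.csInf_eq ⟨hx, fun y hy => not_lt.1 fun hyx => (h y hyx).not_ge hy⟩

theorem exists_lo_eq_of_not_continuousWithinAt (u : FuzzyNumber) {a x : ℝ} (hax : a < x)
    (hx : x ≤ u.lo 1) (h : ¬ ContinuousWithinAt u.f (Iio x) x) :
    ∃ α ∈ Ico (u.f a) (u.f x), u.lo α = u.lo (u.f x) := by
  have hmono := u.monotoneOn_Iic_lo_one
  obtain ⟨ε, hε, hjump⟩ : ∃ ε > 0, ∀ y < x, u.f y ≤ u.f x - ε := by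
    by_contra! hcon
    refine h (Metric.continuousWithinAt_iff.2 fun ε hε => ?_)
    obtain ⟨y, hyx, hy⟩ := hcon ε hε
    refine ⟨x - y, sub_pos.2 hyx, fun {z} hz hzy => ?_⟩
    rw [Real.dist_eq, abs_lt] at hzy ⊢
    have hzx : z ≤ x := le_of_lt hz
    have h1 := hmono (hyx.le.trans hx) (hzx.trans hx) (by linarith : y ≤ z)
    have h2 := hmono (hzx.trans hx) hx hzx
    constructor <;> linarith
  have ha := hjump a hax
  have ha0 := (u.mem_Icc a).1
  refine ⟨u.f x - ε / 2, ⟨by linarith, by linarith⟩, ?_⟩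
  have hlo : ∀ γ, 0 < γ → u.f x - ε < γ → γ ≤ u.f x → u.lo γ = x := fun γ h0 hγ hγx =>
    u.lo_eq_of_forall_lt h0 hγx fun y hy => (hjump y hy).trans_lt hγ
  rw [hlo (u.f x - ε / 2) (by linarith) (by linarith) (by linarith),
    hlo (u.f x) (by linarith) (by linarith) le_rfl]

theorem strictMonoOn_lo_of_continuousWithinAt (u : FuzzyNumber) {a b : ℝ} (ha : a ≤ u.lo 1)
    (h : ∀ x ∈ Ioc a b, ContinuousWithinAt u.f (Iio x) x) :
    StrictMonoOn u.lo (Icc (u.f a) (u.f b)) := by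
  intro α hα β hβ hαβ
  have hα0 : 0 ≤ α := (u.mem_Icc a).1.trans hα.1
  have hβ0 : 0 < β := hα0.trans_lt hαβ
  have hβ1 : β ≤ 1 := hβ.2.trans (u.mem_Icc b).2
  have hfβ : α < u.f (u.lo β) := hαβ.trans_le (u.le_f_lo ⟨hβ0, hβ1⟩)
  have hax : a < u.lo β := by
    by_contra! hle
    exact (hα.1.trans_lt hfβ).not_ge (u.monotoneOn_Iic_lo_one (hle.trans ha) ha hle)
  have hxb : u.lo β ≤ b :=
    csInf_le (u.bddBelow_cut ⟨hβ0.le, hβ1⟩) (by rw [u.cut_of_pos hβ0]; exact hβ.2)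
  obtain ⟨y, hy, hyx⟩ :=
    (((h _ ⟨hax, hxb⟩).eventually_const_lt hfβ).and self_mem_nhdsWithin).exists
  exact (csInf_le (u.bddBelow_cut ⟨hα0, hαβ.le.trans hβ1⟩) (u.mem_cut_of_lt hy)).trans_lt hyx

end FuzzyNumber

/-- Lemma `lec`: for `a < b` in `[u⁻(0), u⁻(1)]`, the following
are equivalent: (i) there is `x ∈ (a,b]` at which `u` is not left-continuous;
(ii) there are `α ≠ β` in `[u(a), u(b)]` with `u⁻(α) = u⁻(β)`;
(iii) `u⁻` is not strictly increasing on `[u(a), u(b)]`. -/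
theorem not_leftCont_tfae (u : FuzzyNumber) (a b : ℝ)
    (ha : a ∈ Set.Icc (u.lo 0) (u.lo 1)) (hb : b ∈ Set.Icc (u.lo 0) (u.lo 1))
    (hab : a < b) :
    List.TFAE [
      ∃ x ∈ Set.Ioc a b, ¬ ContinuousWithinAt u.f (Set.Iio x) x,
      ∃ α ∈ Set.Icc (u.f a) (u.f b), ∃ β ∈ Set.Icc (u.f a) (u.f b),
        α ≠ β ∧ u.lo α = u.lo β,
      ¬ StrictMonoOn u.lo (Set.Icc (u.f a) (u.f b))] := by
  tfae_have 1 → 2 := by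
    rintro ⟨x, hx, h⟩
    have hxb : u.f x ≤ u.f b := u.monotoneOn_Iic_lo_one (hx.2.trans hb.2) hb.2 hx.2
    obtain ⟨α, hα, heq⟩ :=
      u.exists_lo_eq_of_not_continuousWithinAt hx.1 (hx.2.trans hb.2) h
    exact ⟨α, ⟨hα.1, hα.2.le.trans hxb⟩, u.f x, ⟨hα.1.trans hα.2.le, hxb⟩, hα.2.ne, heq⟩
  tfae_have 2 → 3 := by
    rintro ⟨α, hα, β, hβ, hne, heq⟩ h
    exact hne (h.injOn hα hβ heq)
  tfae_have 3 → 1 := by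
    intro h
    by_contra! hcon
    exact h (u.strictMonoOn_lo_of_continuousWithinAt ha.2 hcon)
  tfae_finish
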